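/- arXiv:2503.19230 — 5 statements merged into one kernel-verified Lean document; each statement's English description precedes it below -/
import Mathlib

section
/- Let w ∈ C_K be non-degenerate and write [i,u] for the equivalence class of (i,u) in T̃(τ). Let [i,u] ∈ T̃(τ) and let ([i_n,u_n])_{n≥1} be a sequence in T̃(τ). Then d_τ([i_n,u_n],[i,u]) → 0 as n → ∞ if and only if u_n → u and, for all sufficiently large n, τ_{i_n,i} ≥ u (i.e. [i_n,u] = [i,u]). -/
open scoped ENNReal Classical
open Filter

noncomputable section

/-- A path: a function from time `ℝ` (only `[0,∞)` matters) to `ℝ^d`. -/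
abbrev RPath (d : ℕ) := ℝ → EuclideanSpace ℝ (Fin d)

/-- The lifetime `𝔏(w) = inf{u ≥ 0 : w is constant on [u,∞)} ∈ [0,∞]` (`inf ∅ = ∞`). -/
def lifetime {d : ℕ} (w : RPath d) : ℝ≥0∞ :=
  sInf (ENNReal.ofReal '' {u : ℝ | 0 ≤ u ∧ ∀ s t : ℝ, u ≤ s → u ≤ t → w s = w t})

/-- `τ̄(w,w') = inf{t ≥ 0 : w(t) ≠ w'(t)} ∈ [0,∞]`. -/
def tauBar {d : ℕ} (w w' : RPath d) : ℝ≥0∞ :=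
  sInf (ENNReal.ofReal '' {t : ℝ | 0 ≤ t ∧ w t ≠ w' t})

/-- The branch time `τ(w,w') = min(τ̄(w,w'), 𝔏(w), 𝔏(w'))`. -/
def tau {d : ℕ} (w w' : RPath d) : ℝ≥0∞ :=
  min (tauBar w w') (min (lifetime w) (lifetime w'))

/-- Membership in `C_K`: each coordinate path is continuous on `[0,∞)`, starts at the
origin, and has finite lifetime. -/
def MemCK {d K : ℕ} (w : Fin K → RPath d) : Prop :=
  ∀ i, ContinuousOn (w i) (Set.Ici 0) ∧ w i 0 = 0 ∧ lifetime (w i) < ⊤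

/-- Non-degeneracy of `w ∈ C_K`. -/
def NonDeg {d K : ℕ} (w : Fin K → RPath d) : Prop :=
  (∀ i j : Fin K, i ≠ j →
      0 < tau (w i) (w j) ∧ tau (w i) (w j) < min (tau (w i) (w i)) (tau (w j) (w j))) ∧
  ¬ ∃ i j k : Fin K, i ≠ j ∧ i ≠ k ∧ j ≠ k ∧
      tau (w i) (w j) = tau (w i) (w k) ∧ tau (w i) (w k) = tau (w j) (w k)
/-- The real value of the branch time (finite on `C_K`). -/
def tauR {d : ℕ} (w w' : RPath d) : ℝ := (tau w w').toReal

/-- The function `d_τ` on representatives: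
`d_τ((i,u),(j,v)) = u + v − 2τ_{i,j}` if `min(u,v) > τ_{i,j}`, and `|u − v|` otherwise. -/
def dhat {d : ℕ} (w w' : RPath d) (u v : ℝ) : ℝ :=
  if tauR w w' < min u v then u + v - 2 * tauR w w' else |u - v|

/-- The set `T̂ = {(i,u) : i ∈ [K], 0 ≤ u ≤ τ_{i,i}}`. -/
def ThatT {d K : ℕ} (w : Fin K → RPath d) : Type :=
  {p : Fin K × ℝ // 0 ≤ p.2 ∧ p.2 ≤ tauR (w p.1) (w p.1)}

/-- The relation `(i,u) ∼ (j,v) iff u = v ≤ τ_{i,j}` on `T̂`. -/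
def relT {d K : ℕ} (w : Fin K → RPath d) (p q : ThatT w) : Prop :=
  p.1.2 = q.1.2 ∧ p.1.2 ≤ tauR (w p.1.1) (w q.1.1)

/-- The function `d_τ` on `T̂`. -/
def dhatT {d K : ℕ} (w : Fin K → RPath d) (p q : ThatT w) : ℝ :=
  dhat (w p.1.1) (w q.1.1) p.1.2 q.1.2
theorem abs_sub_le_dhat {d : ℕ} (w w' : RPath d) (u v : ℝ) : |u - v| ≤ dhat w w' u v := by
  unfold dhat
  split_ifs with h
  · obtain ⟨h₁, h₂⟩ := lt_min_iff.mp h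
    exact abs_le.mpr ⟨by linarith, by linarith⟩
  · exact le_rfl

theorem sub_tauR_le_dhat {d : ℕ} (w w' : RPath d) (u v : ℝ) :
    v - tauR w w' ≤ dhat w w' u v := by
  by_cases h : tauR w w' < u
  · unfold dhat
    split_ifs with h'
    · linarith
    · have hv : v ≤ tauR w w' := not_lt.mp fun hv => h' (lt_min h hv)
      linarith [abs_nonneg (u - v)]
  · linarith [abs_sub_le_dhat w w' u v, neg_abs_le (u - v)]

theorem dhat_eq_abs_sub {d : ℕ} {w w' : RPath d} (u : ℝ) {v : ℝ} (h : v ≤ tauR w w') :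
    dhat w w' u v = |u - v| :=
  if_neg fun h' => (lt_min_iff.mp h').2.not_ge h

/-- Lemma `dtauconv`(a): for `[i,u], [i_n,u_n] ∈ T̃(τ)`,
`d_τ([i_n,u_n],[i,u]) → 0` iff `u_n → u` and, for all large `n`, `[i_n,u] = [i,u]`
(i.e. `u ≤ τ_{i_n,i}`). -/
theorem stmt9 {d K : ℕ} (w : Fin K → RPath d) (hw : MemCK w) (hnd : NonDeg w)
    (i : Fin K) (u : ℝ) (hu : 0 ≤ u ∧ u ≤ tauR (w i) (w i))
    (iseq : ℕ → Fin K) (useq : ℕ → ℝ)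
    (hseq : ∀ n, 0 ≤ useq n ∧ useq n ≤ tauR (w (iseq n)) (w (iseq n))) :
    Tendsto (fun n => dhat (w (iseq n)) (w i) (useq n) u) atTop (nhds 0) ↔
      (Tendsto useq atTop (nhds u) ∧
        ∀ᶠ n in atTop, u ≤ tauR (w (iseq n)) (w i)) := by
  constructor
  · intro h
    refine ⟨?_, ?_⟩
    · rw [tendsto_iff_dist_tendsto_zero]
      exact squeeze_zero (fun _ => dist_nonneg)
        (fun n => abs_sub_le_dhat (w (iseq n)) (w i) (useq n) u) h
    · have hj : ∀ j : Fin K, ∀ᶠ n in atTop, iseq n = j → u ≤ tauR (w j) (w i) := by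
        intro j
        by_cases hle : u ≤ tauR (w j) (w i)
        · exact Eventually.of_forall fun _ _ => hle
        · filter_upwards [h.eventually_lt_const (sub_pos.mpr (not_le.mp hle))] with n hn hnj
          rw [hnj] at hn
          exact absurd hn (sub_tauR_le_dhat (w j) (w i) (useq n) u).not_gt
      filter_upwards [eventually_all.mpr hj] with n hn
      exact hn (iseq n) rfl
  · rintro ⟨h, hle⟩
    refine (tendsto_iff_dist_tendsto_zero.mp h).congr' ?_
    filter_upwards [hle] with n hn
    rw [dhat_eq_abs_sub _ hn, Real.dist_eq]

end
end

section
/- Let w ∈ C_K be non-degenerate. Then the map φ_w on T̃(τ) given by φ_w([i,u]) = w_i(u) is well defined (if (i,u) ∼ (j,v) then w_i(u) = w_j(v)) and is continuous from (T̃(τ), d_τ) to ℝ^d: whenever d_τ([i_n,u_n],[i,u]) → 0, one has w_{i_n}(u_n) → w_i(u). -/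
open scoped ENNReal Classical
open Filter

noncomputable section

/-- Two paths agree strictly before their branch time. -/
lemma eq_of_lt_tauR {d : ℕ} {f g : RPath d} {x : ℝ} (h0 : 0 ≤ x) (hx : x < tauR f g) :
    f x = g x := by
  by_contra hne
  have htop : tau f g ≠ ⊤ := by
    intro h
    simp only [tauR, h, ENNReal.toReal_top] at hx
    linarith
  have hlt : ENNReal.ofReal x < tau f g := (ENNReal.ofReal_lt_iff_lt_toReal h0 htop).2 hx
  have hle : tauBar f g ≤ ENNReal.ofReal x := sInf_le ⟨x, ⟨h0, hne⟩, rfl⟩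
  exact absurd (hlt.trans_le (min_le_left _ _)) hle.not_gt

/-- Continuous paths with the same starting point agree up to and including their branch time. -/
lemma eq_of_le_tauR {d : ℕ} {f g : RPath d} (hf : ContinuousOn f (Set.Ici 0))
    (hg : ContinuousOn g (Set.Ici 0)) (hfg : f 0 = g 0) {x : ℝ} (h0 : 0 ≤ x)
    (hx : x ≤ tauR f g) : f x = g x := by
  rcases h0.eq_or_lt with rfl | hpos
  · exact hfg
  have heq : Set.EqOn f g (Set.Ico 0 x) := fun y hy => eq_of_lt_tauR hy.1 (hy.2.trans_le hx)
  exact heq.of_subset_closure (hf.mono Set.Icc_subset_Ici_self) (hg.mono Set.Icc_subset_Ici_self)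
    Set.Ico_subset_Icc_self (closure_Ico hpos.ne).ge (Set.right_mem_Icc.2 h0)

/-- If `(f, v)` is close to `(g, u)` for `dhat`, then `f v` is close to `g u`. -/
lemma exists_dist_lt_of_dhat_lt {d : ℕ} {f g : RPath d} (hf : ContinuousOn f (Set.Ici 0))
    (hg : ContinuousOn g (Set.Ici 0)) (hfg : f 0 = g 0) {u : ℝ} (hu : 0 ≤ u) {ε : ℝ}
    (hε : 0 < ε) :
    ∃ δ > 0, ∀ v, 0 ≤ v → dhat f g v u < δ → dist (f v) (g u) < ε := by
  by_cases h : u ≤ tauR f g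
  · obtain ⟨δ, hδ, H⟩ := Metric.continuousOn_iff.1 hf u hu ε hε
    refine ⟨δ, hδ, fun v hv hd => ?_⟩
    rw [dhat, if_neg (not_lt.2 ((min_le_right v u).trans h))] at hd
    rw [← eq_of_le_tauR hf hg hfg hu h]
    exact H v hv hd
  · push Not at h
    refine ⟨u - tauR f g, sub_pos.2 h, fun v _ hd => absurd hd (not_lt.2 ?_)⟩
    unfold dhat
    split_ifs with hmin
    · linarith [hmin.trans_le (min_le_left v u)]
    · have hv : v ≤ tauR f g := by
        by_contra hc
        exact hmin (lt_min (not_le.1 hc) h)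
      linarith [neg_abs_le (v - u)]

/-- Lemma `dtauconv`(b): the map `φ_w([i,u]) = w_i(u)` is well defined on `T̃(τ)` and
is continuous from `(T̃(τ), d_τ)` to `ℝ^d`. -/
theorem stmt10 {d K : ℕ} (w : Fin K → RPath d) (hw : MemCK w) (hnd : NonDeg w) :
    (∀ (i j : Fin K) (u v : ℝ), 0 ≤ u → u ≤ tauR (w i) (w i) →
        0 ≤ v → v ≤ tauR (w j) (w j) → u = v → u ≤ tauR (w i) (w j) →
        w i u = w j v) ∧
    (∀ (i : Fin K) (u : ℝ), 0 ≤ u → u ≤ tauR (w i) (w i) →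
        ∀ (iseq : ℕ → Fin K) (useq : ℕ → ℝ),
          (∀ n, 0 ≤ useq n ∧ useq n ≤ tauR (w (iseq n)) (w (iseq n))) →
          Tendsto (fun n => dhat (w (iseq n)) (w i) (useq n) u) atTop (nhds 0) →
          Tendsto (fun n => w (iseq n) (useq n)) atTop (nhds (w i u))) := by
  refine ⟨fun i j u v hu _ _ _ huv hτ => ?_, fun i u hu _ iseq useq hseq hlim => ?_⟩
  · subst huv
    exact eq_of_le_tauR (hw i).1 (hw j).1 ((hw i).2.1.trans (hw j).2.1.symm) hu hτ
  · refine Metric.tendsto_nhds.2 fun ε hε => ?_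
    have key : ∀ j, ∀ᶠ n in atTop, iseq n = j → dist (w (iseq n) (useq n)) (w i u) < ε := by
      intro j
      obtain ⟨δ, hδ, H⟩ := exists_dist_lt_of_dhat_lt (hw j).1 (hw i).1
        ((hw j).2.1.trans (hw i).2.1.symm) hu hε
      filter_upwards [hlim.eventually_lt_const hδ] with n hn hj
      subst hj
      exact H _ (hseq n).1 hn
    filter_upwards [eventually_all.2 key] with n hn using hn _ rfl

end
end

section
/- Let f_n, g_n, f, g : [0,∞) → ℝ^d be functions such that f_n → f and g_n → g locally uniformly on [0,∞). Then: (a) liminf_{n→∞} 𝔏(f_n) ≥ 𝔏(f) in [0,∞]; (b) limsup_{n→∞} τ̄(f_n, g_n) ≤ τ̄(f, g) in [0,∞]; (c) if in addition 𝔏(f) < ∞, 𝔏(g) < ∞, 𝔏(f_n) → 𝔏(f) and 𝔏(g_n) → 𝔏(g), then limsup_{n→∞} τ(f_n, g_n) ≤ τ(f, g). -/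
open scoped ENNReal Classical
open Filter

noncomputable section

theorem le_liminf_lifetime {d : ℕ} {ι : Type*} {l : Filter ι} {f : ι → RPath d} {F : RPath d}
    (h : ∀ t : ℝ, 0 ≤ t → Tendsto (fun n => f n t) l (nhds (F t))) :
    lifetime F ≤ liminf (fun n => lifetime (f n)) l := by
  refine le_of_forall_lt fun c hc => ?_
  obtain ⟨b, hcb, hb⟩ := exists_between hc
  refine hcb.trans_le ?_
  have hbt : b ≠ ⊤ := hb.ne_top
  have hnot : ¬ ∀ s t : ℝ, b.toReal ≤ s → b.toReal ≤ t → F s = F t := fun hconst =>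
    hb.not_ge (sInf_le ⟨b.toReal, ⟨ENNReal.toReal_nonneg, hconst⟩, ENNReal.ofReal_toReal hbt⟩)
  push Not at hnot
  obtain ⟨s, t, hs, ht, hst⟩ := hnot
  have hev := ((h s (ENNReal.toReal_nonneg.trans hs)).prodMk_nhds
    (h t (ENNReal.toReal_nonneg.trans ht))).eventually (isOpen_ne_fun continuous_fst
      continuous_snd |>.mem_nhds hst)
  refine le_liminf_of_le (by isBoundedDefault) ?_
  filter_upwards [hev] with n hn
  refine le_sInf ?_
  rintro _ ⟨v, ⟨-, hv⟩, rfl⟩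
  by_contra! hlt
  have hvb : v ≤ b.toReal := (ENNReal.ofReal_le_iff_le_toReal hbt).1 hlt.le
  exact hn (hv s t (hvb.trans hs) (hvb.trans ht))

theorem limsup_tauBar_le {d : ℕ} {ι : Type*} {l : Filter ι} {f g : ι → RPath d} {F G : RPath d}
    (hf : ∀ t : ℝ, 0 ≤ t → Tendsto (fun n => f n t) l (nhds (F t)))
    (hg : ∀ t : ℝ, 0 ≤ t → Tendsto (fun n => g n t) l (nhds (G t))) :
    limsup (fun n => tauBar (f n) (g n)) l ≤ tauBar F G := by
  refine le_sInf ?_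
  rintro _ ⟨t, ⟨ht, hne⟩, rfl⟩
  refine limsup_le_of_le (by isBoundedDefault) ?_
  filter_upwards [((hf t ht).prodMk_nhds (hg t ht)).eventually
    (isOpen_ne_fun continuous_fst continuous_snd |>.mem_nhds hne)] with n hn
  exact sInf_le ⟨t, ⟨ht, hn⟩, rfl⟩

/-- Lemma `uppersemi`: if `f_n → f` and `g_n → g` locally uniformly on `[0,∞)`, then
(a) `𝔏` is lower semicontinuous: `𝔏(f) ≤ liminf 𝔏(f_n)`;
(b) `τ̄` is upper semicontinuous: `limsup τ̄(f_n,g_n) ≤ τ̄(f,g)`;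
(c) if moreover the lifetimes are finite and `𝔏(f_n) → 𝔏(f)`, `𝔏(g_n) → 𝔏(g)`, then
`limsup τ(f_n,g_n) ≤ τ(f,g)`. -/
theorem stmt14 {d : ℕ} (f g : ℕ → RPath d) (F G : RPath d)
    (hf : TendstoLocallyUniformlyOn f F atTop (Set.Ici 0))
    (hg : TendstoLocallyUniformlyOn g G atTop (Set.Ici 0)) :
    lifetime F ≤ Filter.liminf (fun n => lifetime (f n)) atTop ∧
    Filter.limsup (fun n => tauBar (f n) (g n)) atTop ≤ tauBar F G ∧
    (lifetime F < ⊤ → lifetime G < ⊤ →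
      Tendsto (fun n => lifetime (f n)) atTop (nhds (lifetime F)) →
      Tendsto (fun n => lifetime (g n)) atTop (nhds (lifetime G)) →
      Filter.limsup (fun n => tau (f n) (g n)) atTop ≤ tau F G) := by
  have hf' : ∀ t : ℝ, 0 ≤ t → Tendsto (fun n => f n t) atTop (nhds (F t)) :=
    fun t ht => hf.tendsto_at ht
  have hg' : ∀ t : ℝ, 0 ≤ t → Tendsto (fun n => g n t) atTop (nhds (G t)) :=
    fun t ht => hg.tendsto_at ht
  refine ⟨le_liminf_lifetime hf', limsup_tauBar_le hf' hg', fun _ _ hF hG => ?_⟩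
  refine le_min ?_ (le_min ?_ ?_)
  · exact (limsup_le_limsup (Eventually.of_forall fun n => min_le_left _ _)).trans
      (limsup_tauBar_le hf' hg')
  · rw [← hF.limsup_eq]
    exact limsup_le_limsup (Eventually.of_forall fun n =>
      (min_le_right _ _).trans (min_le_left _ _))
  · rw [← hG.limsup_eq]
    exact limsup_le_limsup (Eventually.of_forall fun n =>
      (min_le_right _ _).trans (min_le_right _ _))

end
end

section
/- For n ≥ 1 let κ_n be the mesh-1/n linear interpolation operator on paths. Let w = (w_1,…,w_K) ∈ C_K, and for each n let w^{(n)} = (w^{(n)}_1,…,w^{(n)}_K) be a K-tuple of functions [0,∞) → ℝ^d with w^{(n)}_i(0) = 0 and 𝔏(w^{(n)}_i) < ∞ for all i. Assume that for every i ∈ [K], w^{(n)}_i → w_i locally uniformly on [0,∞), and that τ(w^{(n)}_i, w^{(n)}_j) → τ(w_i, w_j) for all i,j ∈ [K]. Then, as n → ∞: (a) sup_{t≥0} |w^{(n)}_i(t) − w_i(t)| → 0 and sup_{t≥0} |κ_n(w^{(n)}_i)(t) − w_i(t)| → 0 for every i ∈ [K]; and (b) τ(κ_n(w^{(n)}_i),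 κ_n(w^{(n)}_j)) → τ(w_i, w_j) for all i,j ∈ [K]. -/
open scoped ENNReal Classical
open Filter

noncomputable section

/-- The mesh-`1/n` linear interpolation operator `κ_n`: `κ_n(w)` agrees with `w` at the
points `k/n` and is affine on each interval `[k/n, (k+1)/n]`. -/
def interp {d : ℕ} (n : ℕ) (w : RPath d) : RPath d := fun t =>
  w ((⌊(n : ℝ) * t⌋ : ℝ) / n) +
    ((n : ℝ) * t - (⌊(n : ℝ) * t⌋ : ℝ)) •
      (w (((⌊(n : ℝ) * t⌋ : ℝ) + 1) / n) - w ((⌊(n : ℝ) * t⌋ : ℝ) / n))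

lemma exists_of_lifetime_lt {d : ℕ} {w : RPath d} {a : ℝ≥0∞} (h : lifetime w < a) :
    ∃ u : ℝ, 0 ≤ u ∧ (∀ s t : ℝ, u ≤ s → u ≤ t → w s = w t) ∧ ENNReal.ofReal u < a := by
  obtain ⟨_, ⟨u, ⟨hu0, hu⟩, rfl⟩, hua⟩ := sInf_lt_iff.1 h
  exact ⟨u, hu0, hu, hua⟩

lemma lifetime_le {d : ℕ} {w : RPath d} {u : ℝ} (hu : 0 ≤ u)
    (h : ∀ s t : ℝ, u ≤ s → u ≤ t → w s = w t) : lifetime w ≤ ENNReal.ofReal u :=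
  sInf_le ⟨u, ⟨hu, h⟩, rfl⟩

lemma le_lifetime_of_ne {d : ℕ} {w : RPath d} {c a b : ℝ} (ha : c ≤ a) (hb : c ≤ b)
    (hab : w a ≠ w b) : ENNReal.ofReal c ≤ lifetime w := by
  refine le_sInf ?_
  rintro _ ⟨u, ⟨_, hu⟩, rfl⟩
  refine ENNReal.ofReal_le_ofReal ?_
  by_contra! hlt
  exact hab (hu a b (hlt.le.trans ha) (hlt.le.trans hb))

lemma exists_ne_of_lt_lifetime {d : ℕ} {w : RPath d} {c : ℝ} (hc : 0 ≤ c)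
    (h : ENNReal.ofReal c < lifetime w) : ∃ a b : ℝ, c ≤ a ∧ c ≤ b ∧ w a ≠ w b := by
  by_contra! hcon
  exact absurd (lifetime_le hc fun s t hs ht => hcon s t hs ht) (not_le.2 h)

lemma tauBar_self {d : ℕ} (w : RPath d) : tauBar w w = ⊤ := by
  simp [tauBar]

lemma tau_self {d : ℕ} (w : RPath d) : tau w w = lifetime w := by
  simp [tau, tauBar_self]

lemma eq_of_lt_tauBar {d : ℕ} {w w' : RPath d} {t : ℝ} (ht : 0 ≤ t)
    (h : ENNReal.ofReal t < tauBar w w') : w t = w' t := by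
  by_contra hne
  exact absurd (sInf_le ⟨t, ⟨ht, hne⟩, rfl⟩ : tauBar w w' ≤ _) (not_le.2 h)

lemma tauBar_le {d : ℕ} {w w' : RPath d} {t : ℝ} (ht : 0 ≤ t) (h : w t ≠ w' t) :
    tauBar w w' ≤ ENNReal.ofReal t :=
  sInf_le ⟨t, ⟨ht, h⟩, rfl⟩

lemma exists_ne_of_tauBar_lt {d : ℕ} {w w' : RPath d} {a : ℝ≥0∞} (h : tauBar w w' < a) :
    ∃ t : ℝ, 0 ≤ t ∧ w t ≠ w' t ∧ ENNReal.ofReal t < a := by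
  obtain ⟨_, ⟨t, ⟨ht0, ht⟩, rfl⟩, hta⟩ := sInf_lt_iff.1 h
  exact ⟨t, ht0, ht, hta⟩

/-- The grid points used by `interp n` at time `t ≥ 0` are nonnegative and surround `t` within
distance `1 / n`. -/
lemma grid_bounds {n : ℕ} (hn : 0 < n) {t : ℝ} (ht : 0 ≤ t) :
    0 ≤ (⌊(n : ℝ) * t⌋ : ℝ) / n ∧ (⌊(n : ℝ) * t⌋ : ℝ) / n ≤ t ∧
      t - 1 / n ≤ (⌊(n : ℝ) * t⌋ : ℝ) / n ∧ t ≤ ((⌊(n : ℝ) * t⌋ : ℝ) + 1) / n ∧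
      ((⌊(n : ℝ) * t⌋ : ℝ) + 1) / n ≤ t + 1 / n := by
  have hn' : (0 : ℝ) < n := Nat.cast_pos.2 hn
  have h0 : (0 : ℝ) ≤ ⌊(n : ℝ) * t⌋ := by
    exact_mod_cast Int.floor_nonneg.2 (mul_nonneg hn'.le ht)
  have h1 := Int.floor_le ((n : ℝ) * t)
  have h2 := Int.lt_floor_add_one ((n : ℝ) * t)
  have h3 : (⌊(n : ℝ) * t⌋ : ℝ) / n ≤ t := by
    rw [div_le_iff₀ hn']; linarith
  have h4 : t ≤ ((⌊(n : ℝ) * t⌋ : ℝ) + 1) / n := by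
    rw [le_div_iff₀ hn']; linarith
  rw [add_div] at h4 ⊢
  exact ⟨div_nonneg h0 hn'.le, h3, by linarith, h4, by linarith⟩

lemma dist_interp_lt {d : ℕ} {n : ℕ} {w : RPath d} {t ε : ℝ} {x : EuclideanSpace ℝ (Fin d)}
    (h1 : dist (w ((⌊(n : ℝ) * t⌋ : ℝ) / n)) x < ε)
    (h2 : dist (w (((⌊(n : ℝ) * t⌋ : ℝ) + 1) / n)) x < ε) :
    dist (interp n w t) x < ε := by
  have h3 := Int.floor_le ((n : ℝ) * t)
  have h4 := Int.lt_floor_add_one ((n : ℝ) * t)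
  exact (convex_ball x ε).add_smul_sub_mem (Metric.mem_ball.2 h1) (Metric.mem_ball.2 h2)
    ⟨by linarith, by linarith⟩

lemma interp_eq_of_eqOn_Ici {d n : ℕ} (hn : 0 < n) {w : RPath d} {u : ℝ}
    (hu : 0 ≤ u) (h : ∀ s t : ℝ, u ≤ s → u ≤ t → w s = w t) {t : ℝ} (ht : u + 1 / n ≤ t) :
    interp n w t = w u := by
  have hn1 : (0 : ℝ) ≤ 1 / n := by positivity
  obtain ⟨-, -, h2, h3, -⟩ := grid_bounds hn (t := t) (by linarith)
  rw [interp, h _ u (by linarith) le_rfl,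
    h (((⌊(n : ℝ) * t⌋ : ℝ) + 1) / n) u (by linarith) le_rfl]
  simp

lemma lifetime_interp_le {d n : ℕ} (hn : 0 < n) {w : RPath d} {u : ℝ} (hu : 0 ≤ u)
    (h : ∀ s t : ℝ, u ≤ s → u ≤ t → w s = w t) :
    lifetime (interp n w) ≤ ENNReal.ofReal (u + 1 / n) :=
  lifetime_le (by positivity) fun s t hs ht => by
    rw [interp_eq_of_eqOn_Ici hn hu h hs, interp_eq_of_eqOn_Ici hn hu h ht]

lemma le_tauBar_interp {d n : ℕ} (hn : 0 < n) {w w' : RPath d} {c : ℝ}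
    (h : ENNReal.ofReal (c + 1 / n) ≤ tauBar w w') :
    ENNReal.ofReal c ≤ tauBar (interp n w) (interp n w') := by
  have hn1 : (0 : ℝ) < 1 / n := by positivity
  refine le_sInf ?_
  rintro _ ⟨t, ⟨ht0, hne⟩, rfl⟩
  refine ENNReal.ofReal_le_ofReal ?_
  by_contra! htc
  obtain ⟨h0, h1, -, h3, h4⟩ := grid_bounds hn ht0
  have agree : ∀ s : ℝ, 0 ≤ s → s ≤ t + 1 / n → w s = w' s := fun s hs hst =>
    eq_of_lt_tauBar hs <| lt_of_lt_of_le
      ((ENNReal.ofReal_lt_ofReal_iff (by linarith)).2 (by linarith)) h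
  apply hne
  rw [interp, interp, agree _ h0 (by linarith), agree _ (by linarith) h4]

/-- Locally uniform convergence becomes uniform when all paths are eventually constant after a
common time. -/
lemma tendstoUniformlyOn_of_lifetime_lt {d : ℕ} {f : ℕ → RPath d} {g : RPath d} {T : ℝ}
    (hT : 0 ≤ T) (hg : lifetime g < ENNReal.ofReal T)
    (hf : ∀ᶠ n in atTop, lifetime (f n) < ENNReal.ofReal T)
    (h : TendstoLocallyUniformlyOn f g atTop (Set.Ici 0)) :
    TendstoUniformlyOn f g atTop (Set.Ici 0) := by
  have const : ∀ {v : RPath d}, lifetime v < ENNReal.ofReal T → ∀ t, v (min t T) = v t := by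
    intro v hv t
    obtain ⟨u, hu0, hu, huT⟩ := exists_of_lifetime_lt hv
    have huT' := (ENNReal.ofReal_lt_ofReal_iff_of_nonneg hu0).1 huT
    rcases le_total t T with htT | hTt
    · rw [min_eq_left htT]
    · rw [min_eq_right hTt]; exact hu _ _ huT'.le (huT'.le.trans hTt)
  have hc : TendstoUniformlyOn f g atTop (Set.Icc 0 T) :=
    (tendstoLocallyUniformlyOn_iff_tendstoUniformlyOn_of_compact isCompact_Icc).1
      (h.mono Set.Icc_subset_Ici_self)
  rw [Metric.tendstoUniformlyOn_iff] at hc ⊢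
  intro ε hε
  filter_upwards [hc ε hε, hf] with n h1 h2 t ht
  rw [← const hg t, ← const h2 t]
  exact h1 _ ⟨le_min ht hT, min_le_right _ _⟩

lemma uniformContinuousOn_of_lifetime_lt_top {d : ℕ} {g : RPath d}
    (hc : ContinuousOn g (Set.Ici 0)) (hL : lifetime g < ⊤) :
    UniformContinuousOn g (Set.Ici 0) := by
  obtain ⟨u, hu0, hu, -⟩ := exists_of_lifetime_lt hL
  have const : ∀ t, g (min t u) = g t := fun t => by
    rcases le_total t u with h | h
    · rw [min_eq_left h]
    · rw [min_eq_right h]; exact hu _ _ le_rfl h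
  have h := isCompact_Icc.uniformContinuousOn_of_continuous
    (hc.mono (Set.Icc_subset_Ici_self : Set.Icc 0 u ⊆ _))
  rw [Metric.uniformContinuousOn_iff] at h ⊢
  intro ε hε
  obtain ⟨δ, hδ, h⟩ := h ε hε
  refine ⟨δ, hδ, fun s hs t ht hst => ?_⟩
  rw [← const s, ← const t]
  refine h _ ⟨le_min hs hu0, min_le_right _ _⟩ _ ⟨le_min ht hu0, min_le_right _ _⟩ ?_
  refine lt_of_le_of_lt ?_ hst
  simpa [Real.dist_eq] using abs_min_sub_min_le_max s u t u

lemma tendstoUniformlyOn_interp {d : ℕ} {f : ℕ → RPath d} {g : RPath d}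
    (hg : UniformContinuousOn g (Set.Ici 0))
    (h : TendstoUniformlyOn f g atTop (Set.Ici 0)) :
    TendstoUniformlyOn (fun n => interp n (f n)) g atTop (Set.Ici 0) := by
  rw [Metric.tendstoUniformlyOn_iff] at h ⊢
  rw [Metric.uniformContinuousOn_iff] at hg
  intro ε hε
  obtain ⟨δ, hδ, hg⟩ := hg (ε / 2) (half_pos hε)
  filter_upwards [h (ε / 2) (half_pos hε), eventually_gt_atTop 0,
    tendsto_one_div_atTop_nhds_zero_nat.eventually_lt_const hδ] with n hfn hn hnδ t ht
  have ht0 : (0 : ℝ) ≤ t := ht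
  obtain ⟨h0, h1, h2, h3, h4⟩ := grid_bounds hn ht0
  have close : ∀ s : ℝ, 0 ≤ s → |s - t| ≤ 1 / n → dist (f n s) (g t) < ε := by
    intro s hs hst
    have e1 := hfn s hs
    have e2 := hg s hs t ht (hst.trans_lt hnδ)
    rw [dist_comm] at e1
    linarith [dist_triangle (f n s) (g s) (g t)]
  rw [dist_comm]
  exact dist_interp_lt (close _ h0 (abs_le.2 ⟨by linarith, by linarith⟩))
    (close _ (by linarith) (abs_le.2 ⟨by linarith, by linarith⟩))

lemma eventually_ne_of_tendsto {X : Type*} [TopologicalSpace X] [T2Space X] {f g : ℕ → X}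
    {x y : X} (hf : Tendsto f atTop (nhds x)) (hg : Tendsto g atTop (nhds y)) (hxy : x ≠ y) :
    ∀ᶠ n in atTop, f n ≠ g n :=
  (hf.prodMk_nhds hg).eventually
    ((isClosed_diagonal.isOpen_compl).mem_nhds (by simpa using hxy))

lemma eventually_le_lifetime {d : ℕ} {f : ℕ → RPath d} {g : RPath d}
    (h : TendstoUniformlyOn f g atTop (Set.Ici 0)) {c : ℝ} (hc : 0 ≤ c)
    (hcg : ENNReal.ofReal c < lifetime g) :
    ∀ᶠ n in atTop, ENNReal.ofReal c ≤ lifetime (f n) := by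
  obtain ⟨a, b, ha, hb, hab⟩ := exists_ne_of_lt_lifetime hc hcg
  filter_upwards [eventually_ne_of_tendsto (h.tendsto_at (hc.trans ha))
    (h.tendsto_at (hc.trans hb)) hab] with n hn
  exact le_lifetime_of_ne ha hb hn

lemma eventually_tauBar_lt {d : ℕ} {f f' : ℕ → RPath d} {g g' : RPath d}
    (h : TendstoUniformlyOn f g atTop (Set.Ici 0))
    (h' : TendstoUniformlyOn f' g' atTop (Set.Ici 0)) {a : ℝ≥0∞} (ha : tauBar g g' < a) :
    ∀ᶠ n in atTop, tauBar (f n) (f' n) < a := by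
  obtain ⟨t, ht0, hne, hta⟩ := exists_ne_of_tauBar_lt ha
  filter_upwards [eventually_ne_of_tendsto (h.tendsto_at ht0) (h'.tendsto_at ht0) hne] with n hn
  exact (tauBar_le ht0 hn).trans_lt hta

lemma eventually_lifetime_interp_lt {d : ℕ} {f : ℕ → RPath d} {g : RPath d}
    (h : Tendsto (fun n => lifetime (f n)) atTop (nhds (lifetime g))) {a : ℝ≥0∞}
    (ha : lifetime g < a) : ∀ᶠ n in atTop, lifetime (interp n (f n)) < a := by
  obtain ⟨b, hgb, hba⟩ := ENNReal.lt_iff_exists_real_btwn.1 ha |>.imp fun _ h => h.2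
  obtain ⟨c, hbc, hca⟩ := ENNReal.lt_iff_exists_real_btwn.1 hba |>.imp fun _ h => h.2
  have hbc' : b < c := (ENNReal.ofReal_lt_ofReal_iff'.1 hbc).1
  filter_upwards [h.eventually_lt_const hgb, eventually_gt_atTop 0,
    tendsto_one_div_atTop_nhds_zero_nat.eventually_lt_const (sub_pos.2 hbc')] with n hn hn0 hnbc
  obtain ⟨u, hu0, hu, hub⟩ := exists_of_lifetime_lt hn
  have hub' := (ENNReal.ofReal_lt_ofReal_iff_of_nonneg hu0).1 hub
  exact (lifetime_interp_le hn0 hu0 hu).trans_lt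
    ((ENNReal.ofReal_le_ofReal (by linarith)).trans_lt hca)

/-- Lemma `interpol`: if `w ∈ C_K`, `w^{(n)}` have finite lifetimes and start at the
origin, `w^{(n)}_i → w_i` locally uniformly on `[0,∞)` and
`τ(w^{(n)}_i, w^{(n)}_j) → τ(w_i,w_j)`, then (a) `w^{(n)}_i → w_i` and
`κ_n(w^{(n)}_i) → w_i` uniformly on `[0,∞)`, and (b)
`τ(κ_n(w^{(n)}_i), κ_n(w^{(n)}_j)) → τ(w_i,w_j)`. -/
theorem stmt15 {d K : ℕ} (w : Fin K → RPath d) (hw : MemCK w)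
    (wn : ℕ → Fin K → RPath d)
    (hwn0 : ∀ n i, wn n i 0 = 0) (hwnL : ∀ n i, lifetime (wn n i) < ⊤)
    (hconv : ∀ i, TendstoLocallyUniformlyOn (fun n => wn n i) (w i) atTop (Set.Ici 0))
    (htau : ∀ i j, Tendsto (fun n => tau (wn n i) (wn n j)) atTop
        (nhds (tau (w i) (w j)))) :
    (∀ i, TendstoUniformlyOn (fun n => wn n i) (w i) atTop (Set.Ici 0) ∧
        TendstoUniformlyOn (fun n => interp n (wn n i)) (w i) atTop (Set.Ici 0)) ∧
    (∀ i j, Tendsto (fun n => tau (interp n (wn n i)) (interp n (wn n j))) atTop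
        (nhds (tau (w i) (w j)))) := by
  have hlife : ∀ i, Tendsto (fun n => lifetime (wn n i)) atTop (nhds (lifetime (w i))) :=
    fun i => by simpa only [tau_self] using htau i i
  have hunif : ∀ i, TendstoUniformlyOn (fun n => wn n i) (w i) atTop (Set.Ici 0) := fun i => by
    obtain ⟨T, hT0, hT, -⟩ := ENNReal.lt_iff_exists_real_btwn.1 (hw i).2.2
    exact tendstoUniformlyOn_of_lifetime_lt hT0 hT ((hlife i).eventually_lt_const hT) (hconv i)
  have hinterp : ∀ i,
      TendstoUniformlyOn (fun n => interp n (wn n i)) (w i) atTop (Set.Ici 0) := fun i =>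
    tendstoUniformlyOn_interp
      (uniformContinuousOn_of_lifetime_lt_top (hw i).1 (hw i).2.2) (hunif i)
  refine ⟨fun i => ⟨hunif i, hinterp i⟩,
    fun i j => tendsto_order.2 ⟨fun a ha => ?_, fun a ha => ?_⟩⟩
  · obtain ⟨c, hc0, hac, hcτ⟩ := ENNReal.lt_iff_exists_real_btwn.1 ha
    obtain ⟨b, -, hcb, hbτ⟩ := ENNReal.lt_iff_exists_real_btwn.1 hcτ
    have hcb' : c < b := (ENNReal.ofReal_lt_ofReal_iff'.1 hcb).1
    have hcL := lt_min_iff.1 (lt_min_iff.1 hcτ).2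
    filter_upwards [(htau i j).eventually_const_lt hbτ, eventually_gt_atTop 0,
      tendsto_one_div_atTop_nhds_zero_nat.eventually_lt_const (sub_pos.2 hcb'),
      eventually_le_lifetime (hinterp i) hc0 hcL.1,
      eventually_le_lifetime (hinterp j) hc0 hcL.2] with n hn hn0 hnbc hi hj
    refine hac.trans_le (le_min (le_tauBar_interp hn0 ?_) (le_min hi hj))
    exact (ENNReal.ofReal_le_ofReal (by linarith)).trans (lt_min_iff.1 hn).1.le
  · rcases min_lt_iff.1 ha with h | h
    · filter_upwards [eventually_tauBar_lt (hinterp i) (hinterp j) h] with n hn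
      exact min_lt_iff.2 (Or.inl hn)
    rcases min_lt_iff.1 h with h | h
    · filter_upwards [eventually_lifetime_interp_lt (hlife i) h] with n hn
      exact min_lt_iff.2 (Or.inr (min_lt_iff.2 (Or.inl hn)))
    · filter_upwards [eventually_lifetime_interp_lt (hlife j) h] with n hn
      exact min_lt_iff.2 (Or.inr (min_lt_iff.2 (Or.inr hn)))

end
end

section
/- Fix K ∈ ℕ and let E₁, E₂ be Polish spaces. For each n let (Z^{(n)}, M^{(n)}) be a random element of E₁ × M_F(E₂) with M^{(n)}(E₂) > 0 a.s., and let V^{(n)} = (V^{(n)}_1,…,V^{(n)}_K) be an E₂^K-valued random vector such that for every bounded continuous φ₂ : E₂^K → ℝ, E[φ₂(V^{(n)}) | Z^{(n)}, M^{(n)}] = ∫ φ₂ dF_K(M^{(n)}) a.s. Let (Z, M) be a random element of E₁ × M_F(E₂) with M(E₂) > 0 a.s., and V = (V_1,…,V_K) an E₂^K-valued random vector with E[φ₂(V) | Z, M] = ∫ φ₂ dF_K(M) a.s. for all bounded continuous φ₂. If (Z^{(n)}, M^{(n)}) converges weakly (in distribution) to (Z, M) in E₁ × M_F(E₂), then (Z^{(n)},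 M^{(n)}, V^{(n)}) converges weakly to (Z, M, V) in E₁ × M_F(E₂) × E₂^K. -/
open MeasureTheory Filter
open scoped ENNReal BoundedContinuousFunction

/-- The (unnormalised-to-normalised) `K`-fold product `F_K(μ)`: for `μ ≠ 0` this is the
normalised product measure `(μ × ⋯ × μ)/μ(E₂)^K`, and it is the zero measure if
`μ = 0`. -/
noncomputable def FKmeas {E₂ : Type*} [MeasurableSpace E₂] (K : ℕ) (μ : Measure E₂) :
    Measure (Fin K → E₂) :=
  (μ Set.univ ^ K)⁻¹ • Measure.pi fun _ : Fin K => μ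

open Set Topology ProbabilityTheory TopologicalSpace

section Separating

variable {V : Type*} [TopologicalSpace V] [MeasurableSpace V] [BorelSpace V]

/-- A second countable space has a countable π-system of closed sets generating its Borel sets. -/
lemma exists_countable_isPiSystem_isClosed (V : Type*) [TopologicalSpace V] [MeasurableSpace V]
    [BorelSpace V] [SecondCountableTopology V] :
    ∃ C : Set (Set V), C.Countable ∧ IsPiSystem C ∧ (∀ s ∈ C, IsClosed s) ∧ univ ∈ C ∧
      ‹MeasurableSpace V› = MeasurableSpace.generateFrom C := by
  refine ⟨(fun t => (⋃₀ t)ᶜ) '' {t | t.Finite ∧ t ⊆ countableBasis V},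
    (countable_ofPred_finite_subset (countable_countableBasis V)).image _, ?_, ?_, ?_, ?_⟩
  · rintro - ⟨t, ⟨ht, htB⟩, rfl⟩ - ⟨t', ⟨ht', htB'⟩, rfl⟩ -
    exact ⟨t ∪ t', ⟨ht.union ht', union_subset htB htB'⟩, by
      simp only [sUnion_union, compl_union]⟩
  · rintro - ⟨t, ⟨-, htB⟩, rfl⟩
    exact (isOpen_sUnion fun s hs => isOpen_of_mem_countableBasis (htB hs)).isClosed_compl
  · exact ⟨∅, ⟨finite_empty, empty_subset _⟩, by simp⟩
  · apply le_antisymm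
    · rw [BorelSpace.measurable_eq (α := V), (isBasis_countableBasis V).borel_eq_generateFrom]
      refine MeasurableSpace.generateFrom_le fun s hs => ?_
      rw [← compl_compl s]
      refine (MeasurableSpace.measurableSet_generateFrom ?_).compl
      exact ⟨{s}, ⟨finite_singleton s, singleton_subset_iff.2 hs⟩, by simp⟩
    · refine MeasurableSpace.generateFrom_le ?_
      rintro - ⟨t, ⟨-, htB⟩, rfl⟩
      exact (isOpen_sUnion fun s hs =>
        isOpen_of_mem_countableBasis (htB hs)).measurableSet.compl

/-- Random finite measures on a second countable space agree almost surely as soon as, for each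
bounded continuous function, its integrals agree almost surely. -/
lemma ae_eq_of_forall_ae_integral_eq [SecondCountableTopology V] [HasOuterApproxClosed V]
    {Ω : Type*} [MeasurableSpace Ω] {P : Measure Ω} {μ ν : Ω → Measure V}
    [∀ ω, IsFiniteMeasure (μ ω)] [∀ ω, IsFiniteMeasure (ν ω)]
    (h : ∀ f : V →ᵇ ℝ, ∀ᵐ ω ∂P, ∫ x, f x ∂μ ω = ∫ x, f x ∂ν ω) : μ =ᵐ[P] ν := by
  obtain ⟨C, hC, hpi, hclosed, huniv, hgen⟩ := exists_countable_isPiSystem_isClosed V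
  have key : ∀ᵐ ω ∂P, ∀ s ∈ C, μ ω s = ν ω s := by
    refine (ae_ball_iff hC).2 fun s hs => ?_
    have hall : ∀ᵐ ω ∂P, ∀ n, ∫⁻ x, (hclosed s hs).apprSeq n x ∂μ ω
        = ∫⁻ x, (hclosed s hs).apprSeq n x ∂ν ω := by
      refine ae_all_iff.2 fun n => ?_
      set f := (hclosed s hs).apprSeq n
      filter_upwards [h ⟨⟨fun x => (f x : ℝ), NNReal.continuous_coe.comp f.continuous⟩,
        f.map_bounded'⟩] with ω hω
      apply (ENNReal.toReal_eq_toReal_iff'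
        (BoundedContinuousFunction.lintegral_lt_top_of_nnreal _ f).ne
        (BoundedContinuousFunction.lintegral_lt_top_of_nnreal _ f).ne).mp
      rw [BoundedContinuousFunction.toReal_lintegral_coe_eq_integral,
        BoundedContinuousFunction.toReal_lintegral_coe_eq_integral]
      exact hω
    filter_upwards [hall] with ω hω
    have hμ := HasOuterApproxClosed.tendsto_lintegral_apprSeq (hclosed s hs) (μ ω)
    have hν := HasOuterApproxClosed.tendsto_lintegral_apprSeq (hclosed s hs) (ν ω)
    simp_rw [hω] at hμ
    exact tendsto_nhds_unique hμ hν
  filter_upwards [key] with ω hω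
  exact ext_of_generate_finite C hgen hpi hω (hω univ huniv)

end Separating

/-- If `ν` is a version of the conditional law of `Y` given `ξ`, as tested by bounded continuous
functions, then bounded continuous functions of `(ξ, Y)` may be integrated iteratively. -/
lemma integral_eq_integral_integral_of_condExp_eq {Ω X V : Type*} [MeasurableSpace Ω]
    {P : Measure Ω} [IsProbabilityMeasure P]
    [TopologicalSpace X] [MeasurableSpace X] [BorelSpace X]
    [TopologicalSpace V] [PolishSpace V] [MeasurableSpace V] [BorelSpace V]
    {ξ : Ω → X} {Y : Ω → V} (hξ : Measurable ξ) (hY : AEMeasurable Y P)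
    {ν : Ω → Measure V} [∀ ω, IsFiniteMeasure (ν ω)]
    (h : ∀ f : V →ᵇ ℝ, P[(fun ω => f (Y ω)) | MeasurableSpace.comap ξ inferInstance]
      =ᵐ[P] fun ω => ∫ x, f x ∂ν ω) (φ : X × V →ᵇ ℝ) :
    ∫ ω, φ (ξ ω, Y ω) ∂P = ∫ ω, ∫ v, φ (ξ ω, v) ∂ν ω ∂P := by
  have : Nonempty V := ⟨Y P.nonempty_of_neZero.some⟩
  have hκ : (fun ω => condDistrib Y ξ P (ξ ω)) =ᵐ[P] ν := by
    refine ae_eq_of_forall_ae_integral_eq fun f => ?_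
    have hf : Integrable (fun ω => f (Y ω)) P :=
      .of_bound (f.continuous.measurable.comp_aemeasurable hY).aestronglyMeasurable ‖f‖
        (ae_of_all _ fun ω => f.norm_coe_le_norm _)
    filter_upwards [condExp_ae_eq_integral_condDistrib hξ hY
      f.continuous.measurable.stronglyMeasurable hf, h f] with ω h₁ h₂
    rw [← h₁, h₂]
  have hpair : AEMeasurable (fun ω => (ξ ω, Y ω)) P := hξ.aemeasurable.prodMk hY
  have hφ : StronglyMeasurable φ := φ.continuous.measurable.stronglyMeasurable
  have : IsProbabilityMeasure (P.map fun ω => (ξ ω, Y ω)) := Measure.isProbabilityMeasure_map hpair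
  have hint : Integrable φ (P.map fun ω => (ξ ω, Y ω)) :=
    .of_bound hφ.aestronglyMeasurable ‖φ‖ (ae_of_all _ fun _ => φ.norm_coe_le_norm _)
  rw [← integral_map (φ := fun ω => (ξ ω, Y ω)) hpair hφ.aestronglyMeasurable,
    ← compProd_map_condDistrib hY, Measure.integral_compProd, integral_map hξ.aemeasurable]
  · refine integral_congr_ae ?_
    filter_upwards [hκ] with ω hω
    rw [hω]
  · exact hφ.integral_condDistrib.aestronglyMeasurable
  · rwa [compProd_map_condDistrib hY]

/-- Integrals of a jointly continuous bounded function against a weakly continuous family of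
probability measures depend continuously on the parameter. -/
lemma continuousAt_integral_probabilityMeasure {X V : Type*} [TopologicalSpace X]
    [TopologicalSpace V] [PolishSpace V] [MeasurableSpace V] [BorelSpace V]
    {ν : X → ProbabilityMeasure V} {x₀ : X} (hν : ContinuousAt ν x₀) (φ : X × V →ᵇ ℝ) :
    ContinuousAt (fun x => ∫ v, φ (x, v) ∂(ν x : Measure V)) x₀ := by
  set g : V →ᵇ ℝ := φ.compContinuous ⟨fun v => (x₀, v), by fun_prop⟩
  have hlim : Tendsto (fun x => ∫ v, φ (x₀, v) ∂(ν x : Measure V)) (𝓝 x₀)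
      (𝓝 (∫ v, φ (x₀, v) ∂(ν x₀ : Measure V))) :=
    ProbabilityMeasure.tendsto_iff_forall_integral_tendsto.1 hν g
  suffices hdiff : Tendsto (fun x => ∫ v, φ (x, v) ∂(ν x : Measure V)
      - ∫ v, φ (x₀, v) ∂(ν x : Measure V)) (𝓝 x₀) (𝓝 0) by
    simpa [ContinuousAt] using hdiff.add hlim
  rw [Metric.tendsto_nhds]
  intro ε hε
  obtain ⟨δ, hδ, hδ1, hδε⟩ : ∃ δ : ℝ, 0 < δ ∧ δ ≤ 1 ∧ δ + 2 * ‖φ‖ * δ < ε := by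
    have hφ : 0 < 1 + 2 * ‖φ‖ := by positivity
    refine ⟨min 1 (ε / 2 / (1 + 2 * ‖φ‖)), by positivity, min_le_left _ _, ?_⟩
    rw [← one_add_mul]
    refine (mul_le_mul_of_nonneg_left (min_le_right _ _) hφ.le).trans_lt ?_
    rw [mul_div_cancel₀ _ hφ.ne']
    linarith
  obtain ⟨K, hK, hKδ⟩ := exists_isCompact_closure_measure_compl_lt (ν x₀ : Measure V)
    (ENNReal.ofReal δ) (by simpa using hδ)
  obtain ⟨U, W, hU, hW, hxU, hKW, hUW⟩ := generalized_tube_lemma (isCompact_singleton (x := x₀))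
    hK (n := {p | |φ p - φ (x₀, p.2)| < δ})
    (isOpen_lt (by fun_prop) continuous_const) (by
      rintro ⟨x, v⟩ ⟨hx, -⟩
      obtain rfl : x = x₀ := hx
      simpa using hδ)
  have hWx₀ : 1 - ENNReal.ofReal δ < (ν x₀ : Measure V) W := by
    have h1 : (ν x₀ : Measure V) Wᶜ < ENNReal.ofReal δ :=
      (measure_mono (compl_subset_compl.2 (subset_closure.trans hKW))).trans_lt hKδ
    refine ENNReal.sub_lt_of_lt_add (by simpa using hδ1) ?_
    rw [← prob_add_prob_compl (μ := (ν x₀ : Measure V)) hW.measurableSet]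
    exact ENNReal.add_lt_add_left (measure_ne_top _ _) h1
  have hev : ∀ᶠ x in 𝓝 x₀, 1 - ENNReal.ofReal δ < (ν x : Measure V) W :=
    eventually_lt_of_lt_liminf
      (hWx₀.trans_le (ProbabilityMeasure.le_liminf_measure_open_of_tendsto hν hW))
  filter_upwards [hev, hU.mem_nhds (hxU rfl)] with x hx hxU'
  have hWc : (ν x : Measure V).real Wᶜ ≤ δ := by
    rw [measureReal_def]
    refine ENNReal.toReal_le_of_le_ofReal hδ.le ?_
    rw [prob_compl_eq_one_sub hW.measurableSet, tsub_le_iff_right, add_comm]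
    exact tsub_le_iff_right.1 hx.le
  have hint : ∀ y, Integrable (fun v => φ (y, v)) (ν x : Measure V) := fun y =>
    (φ.compContinuous ⟨fun v => (y, v), by fun_prop⟩).integrable _
  have hbound : ∀ v, ‖φ (x, v) - φ (x₀, v)‖ ≤ δ + Wᶜ.indicator (fun _ => 2 * ‖φ‖) v := by
    intro v
    by_cases hv : v ∈ W
    · simpa [hv] using (hUW (mk_mem_prod hxU' hv)).le
    · have := norm_sub_le_of_le (φ.norm_coe_le_norm (x, v)) (φ.norm_coe_le_norm (x₀, v))
      rw [indicator_of_mem (by exact hv)]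
      linarith
  rw [dist_zero_right, ← integral_sub (hint _) (hint _)]
  calc ‖∫ v, φ (x, v) - φ (x₀, v) ∂(ν x : Measure V)‖
      ≤ ∫ v, δ + Wᶜ.indicator (fun _ => 2 * ‖φ‖) v ∂(ν x : Measure V) :=
        norm_integral_le_of_norm_le ((integrable_const _).add
          ((integrable_const _).indicator hW.measurableSet.compl)) (ae_of_all _ hbound)
    _ = δ + 2 * ‖φ‖ * (ν x : Measure V).real Wᶜ := by
        rw [integral_add (integrable_const _)
          ((integrable_const _).indicator hW.measurableSet.compl),
          integral_indicator hW.measurableSet.compl]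
        simp [mul_comm]
    _ ≤ δ + 2 * ‖φ‖ * δ := by gcongr
    _ < ε := hδε

lemma ne_zero_of_univ_pos {E : Type*} [MeasurableSpace E] {m : FiniteMeasure E}
    (hm : 0 < (m : Measure E) univ) : m ≠ 0 := by
  rintro rfl
  simp at hm

/-- For a nonzero measure, `FKmeas` is the law of an i.i.d. sample from the normalisation. -/
lemma FKmeas_eq_pi_normalize {E : Type*} [MeasurableSpace E] [Nonempty E] (K : ℕ)
    {m : FiniteMeasure E} (hm : m ≠ 0) :
    FKmeas K (m : Measure E)
      = (ProbabilityMeasure.pi fun _ : Fin K => m.normalize : Measure (Fin K → E)) := by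
  rw [ProbabilityMeasure.toMeasure_pi]
  refine (Measure.pi_eq fun s _ => ?_).symm
  rw [FKmeas, Measure.smul_apply, Measure.pi_pi, m.toMeasure_normalize_eq_of_nonzero hm]
  have hinv : ∀ t, (m.mass⁻¹ • (m : Measure E)) t = (m.mass : ℝ≥0∞)⁻¹ * (m : Measure E) t :=
    fun t => by
      rw [Measure.coe_nnreal_smul_apply, ENNReal.coe_inv (m.mass_nonzero_iff.2 hm)]
  simp_rw [hinv]
  rw [Finset.prod_mul_distrib, Finset.prod_const, Finset.card_univ, Fintype.card_fin,
    ENNReal.inv_pow, FiniteMeasure.ennreal_mass, smul_eq_mul]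

/-- The integral of `φ (x, ·)` against a `K`-fold sample from the normalisation of the measure
component of `x` becomes bounded continuous in `x` after damping by a function `χ` vanishing where
that measure is zero. -/
lemma exists_boundedContinuousFunction_damped {E₁ E₂ : Type*} [TopologicalSpace E₁]
    [TopologicalSpace E₂] [PolishSpace E₂] [MeasurableSpace E₂] [BorelSpace E₂] [Nonempty E₂]
    (K : ℕ) (φ : (E₁ × FiniteMeasure E₂) × (Fin K → E₂) →ᵇ ℝ)
    (χ : E₁ × FiniteMeasure E₂ →ᵇ ℝ) (hχ : ∀ x, x.2 = 0 → χ x = 0) :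
    ∃ Ψ : E₁ × FiniteMeasure E₂ →ᵇ ℝ, ∀ x, Ψ x = ∫ v, φ (x, v) * χ x
      ∂(ProbabilityMeasure.pi fun _ : Fin K => x.2.normalize : Measure (Fin K → E₂)) := by
  set ν : E₁ × FiniteMeasure E₂ → ProbabilityMeasure (Fin K → E₂) :=
    fun x => ProbabilityMeasure.pi fun _ => x.2.normalize
  have hbound : ∀ x, ‖∫ v, φ (x, v) ∂(ν x : Measure (Fin K → E₂))‖ ≤ ‖φ‖ := fun x => by
    simpa using norm_integral_le_of_norm_le_const (μ := (ν x : Measure (Fin K → E₂)))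
      (ae_of_all _ fun v => φ.norm_coe_le_norm (x, v))
  have hcont : Continuous fun x => (∫ v, φ (x, v) ∂(ν x : Measure (Fin K → E₂))) * χ x := by
    refine continuous_iff_continuousAt.2 fun x => ?_
    by_cases hx : x.2 = 0
    · have hχx : Tendsto (fun y => ‖φ‖ * ‖χ y‖) (𝓝 x) (𝓝 0) := by
        have : Continuous fun y => ‖φ‖ * ‖χ y‖ := by fun_prop
        simpa [hχ x hx] using this.tendsto x
      rw [ContinuousAt, hχ x hx, mul_zero]
      refine squeeze_zero_norm (fun y => ?_) hχx
      rw [norm_mul]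
      gcongr
      exact hbound y
    · refine (continuousAt_integral_probabilityMeasure ?_ φ).mul χ.continuous.continuousAt
      refine ProbabilityMeasure.continuous_pi.continuousAt.comp
        (continuousAt_pi.2 fun _ => ?_)
      exact FiniteMeasure.tendsto_normalize_of_tendsto (continuous_snd.tendsto x) hx
  refine ⟨.ofNormedAddCommGroup _ hcont (‖φ‖ * ‖χ‖) fun x => ?_, fun x => ?_⟩
  · rw [norm_mul]
    gcongr
    exacts [hbound x, χ.norm_coe_le_norm x]
  · exact (integral_mul_const _ _).symm

/-- The `k`-th continuous cutoff on `E₁ × M_F(E₂)`, vanishing where the measure is zero. -/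
noncomputable def massCutoff (E₁ E₂ : Type*) [TopologicalSpace E₁] [TopologicalSpace E₂]
    [MeasurableSpace E₂] [OpensMeasurableSpace E₂] (k : ℕ) : E₁ × FiniteMeasure E₂ →ᵇ ℝ :=
  .ofNormedAddCommGroup (fun x => min 1 (k * (x.2.mass : ℝ))) (by fun_prop) 1 fun x => by
    rw [Real.norm_of_nonneg (by positivity)]
    exact min_le_left _ _

section Cutoff

variable {E₁ E₂ : Type*} [TopologicalSpace E₁] [TopologicalSpace E₂] [MeasurableSpace E₂]
  [OpensMeasurableSpace E₂]

lemma massCutoff_apply (k : ℕ) (x : E₁ × FiniteMeasure E₂) :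
    massCutoff E₁ E₂ k x = min 1 (k * (x.2.mass : ℝ)) := rfl

lemma massCutoff_nonneg (k : ℕ) (x : E₁ × FiniteMeasure E₂) : 0 ≤ massCutoff E₁ E₂ k x := by
  rw [massCutoff_apply]
  positivity

lemma massCutoff_le_one (k : ℕ) (x : E₁ × FiniteMeasure E₂) : massCutoff E₁ E₂ k x ≤ 1 :=
  min_le_left _ _

lemma massCutoff_eq_zero (k : ℕ) {x : E₁ × FiniteMeasure E₂} (hx : x.2 = 0) :
    massCutoff E₁ E₂ k x = 0 := by
  simp [massCutoff_apply, hx]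

lemma tendsto_massCutoff {x : E₁ × FiniteMeasure E₂} (hx : x.2 ≠ 0) :
    Tendsto (fun k => massCutoff E₁ E₂ k x) atTop (𝓝 1) := by
  have hm : 0 < (x.2.mass : ℝ) := by
    rw [NNReal.coe_pos, pos_iff_ne_zero, FiniteMeasure.mass_nonzero_iff]
    exact hx
  refine tendsto_const_nhds.congr' ?_
  filter_upwards [(tendsto_natCast_atTop_atTop.atTop_mul_const hm).eventually_ge_atTop 1] with k hk
  exact (min_eq_left hk).symm

end Cutoff

lemma tendsto_of_forall_abs_sub_le {ι : Type*} {l : Filter ι} {a : ι → ℝ} {a' : ℝ}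
    {b e : ℕ → ι → ℝ} {b' e' : ℕ → ℝ}
    (hb : ∀ k, Tendsto (b k) l (𝓝 (b' k))) (he : ∀ k, Tendsto (e k) l (𝓝 (e' k)))
    (he' : Tendsto e' atTop (𝓝 0)) (hab : ∀ k i, |a i - b k i| ≤ e k i)
    (hab' : ∀ k, |a' - b' k| ≤ e' k) : Tendsto a l (𝓝 a') := by
  rw [Metric.tendsto_nhds]
  intro ε hε
  obtain ⟨k, hk⟩ := (he'.eventually (gt_mem_nhds (show 0 < ε / 4 by positivity))).exists
  filter_upwards [(he k).eventually (gt_mem_nhds hk),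
    Metric.tendsto_nhds.1 (hb k) (ε / 4) (by positivity)] with i hi hbi
  rw [Real.dist_eq] at hbi ⊢
  have h1 := abs_le.1 (hab k i)
  have h2 := abs_le.1 (hab' k)
  have h3 := abs_lt.1 hbi
  exact abs_lt.2 ⟨by linarith, by linarith⟩

lemma nonempty_of_ae_univ_pos {E Ω : Type*} [MeasurableSpace E] [MeasurableSpace Ω]
    {P : Measure Ω} [NeZero P] {M : Ω → FiniteMeasure E}
    (hpos : ∀ᵐ ω ∂P, 0 < (M ω : Measure E) univ) : Nonempty E := by
  obtain ⟨ω, hω⟩ := hpos.exists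
  exact (nonempty_of_measure_ne_zero hω.ne').to_type

section Sampling

variable {E₁ E₂ Ω : Type*} [TopologicalSpace E₁] [TopologicalSpace E₂] [MeasurableSpace E₂]
  [BorelSpace E₂] {K : ℕ} [MeasurableSpace Ω] {P : Measure Ω}
  [IsProbabilityMeasure P] {Z : Ω → E₁} {M : Ω → FiniteMeasure E₂} {V : Ω → Fin K → E₂}

/-- The sampling hypothesis forces `(Z, M)` to be Borel measurable, since a conditional
expectation with respect to a σ-algebra that is not coarser than the ambient one is zero. -/
lemma comap_le_of_condExp_eq (hpos : ∀ᵐ ω ∂P, 0 < (M ω : Measure E₂) univ)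
    (hcond : ∀ φ₂ : (Fin K → E₂) →ᵇ ℝ,
      P[(fun ω => φ₂ (V ω)) | MeasurableSpace.comap (fun ω => (Z ω, M ω))
          (borel (E₁ × FiniteMeasure E₂))]
        =ᵐ[P] fun ω => ∫ x, φ₂ x ∂(FKmeas K (M ω : Measure E₂))) :
    MeasurableSpace.comap (fun ω => (Z ω, M ω)) (borel (E₁ × FiniteMeasure E₂))
      ≤ ‹MeasurableSpace Ω› := by
  by_contra hle
  have := nonempty_of_ae_univ_pos hpos
  have h := hcond (BoundedContinuousFunction.const _ 1)
  rw [condExp_of_not_le hle] at h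
  obtain ⟨ω, hω, hω'⟩ := (h.and hpos).exists
  beta_reduce at hω
  rw [FKmeas_eq_pi_normalize K (ne_zero_of_univ_pos hω')] at hω
  simp at hω

lemma integral_eq_integral_pi_normalize [PolishSpace E₂] [Nonempty E₂]
    (hmeas : AEStronglyMeasurable (fun ω => (Z ω, M ω, V ω)) P)
    (hpos : ∀ᵐ ω ∂P, 0 < (M ω : Measure E₂) univ)
    (hcond : ∀ φ₂ : (Fin K → E₂) →ᵇ ℝ,
      P[(fun ω => φ₂ (V ω)) | MeasurableSpace.comap (fun ω => (Z ω, M ω))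
          (borel (E₁ × FiniteMeasure E₂))]
        =ᵐ[P] fun ω => ∫ x, φ₂ x ∂(FKmeas K (M ω : Measure E₂)))
    (φ : (E₁ × FiniteMeasure E₂) × (Fin K → E₂) →ᵇ ℝ) :
    ∫ ω, φ ((Z ω, M ω), V ω) ∂P = ∫ ω, ∫ v, φ ((Z ω, M ω), v)
      ∂(ProbabilityMeasure.pi fun _ : Fin K => (M ω).normalize : Measure (Fin K → E₂)) ∂P := by
  let : MeasurableSpace (E₁ × FiniteMeasure E₂) := borel _
  have : BorelSpace (E₁ × FiniteMeasure E₂) := ⟨rfl⟩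
  refine integral_eq_integral_integral_of_condExp_eq
    (ξ := fun ω => (Z ω, M ω)) (measurable_iff_comap_le.2 (comap_le_of_condExp_eq hpos hcond))
    (continuous_snd.comp_aestronglyMeasurable
      (continuous_snd.comp_aestronglyMeasurable hmeas)).aemeasurable (fun f => ?_) φ
  refine (hcond f).trans ?_
  filter_upwards [hpos] with ω hω
  rw [FKmeas_eq_pi_normalize K (ne_zero_of_univ_pos hω)]

/-- Error made by damping near the zero measure. -/
lemma abs_integral_sub_integral_massCutoff_le
    (hmeas : AEStronglyMeasurable (fun ω => (Z ω, M ω, V ω)) P)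
    (φ : (E₁ × FiniteMeasure E₂) × (Fin K → E₂) →ᵇ ℝ) (k : ℕ) :
    |∫ ω, φ ((Z ω, M ω), V ω) ∂P
        - ∫ ω, φ ((Z ω, M ω), V ω) * massCutoff E₁ E₂ k (Z ω, M ω) ∂P|
      ≤ ‖φ‖ * (1 - ∫ ω, massCutoff E₁ E₂ k (Z ω, M ω) ∂P) := by
  have hint : ∀ ψ : (E₁ × FiniteMeasure E₂) × (Fin K → E₂) →ᵇ ℝ,
      Integrable (fun ω => ψ ((Z ω, M ω), V ω)) P := fun ψ =>
    .of_bound ((ψ.continuous.comp (f := fun p : E₁ × FiniteMeasure E₂ × (Fin K → E₂) =>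
      ((p.1, p.2.1), p.2.2)) (by fun_prop)).comp_aestronglyMeasurable hmeas) ‖ψ‖
      (ae_of_all _ fun _ => ψ.norm_coe_le_norm _)
  set χ : (E₁ × FiniteMeasure E₂) × (Fin K → E₂) →ᵇ ℝ :=
    (massCutoff E₁ E₂ k).compContinuous ⟨Prod.fst, continuous_fst⟩
  have hχ : Integrable (fun ω => massCutoff E₁ E₂ k (Z ω, M ω)) P := hint χ
  have hφχ : Integrable (fun ω => φ ((Z ω, M ω), V ω) * massCutoff E₁ E₂ k (Z ω, M ω)) P :=
    hint (φ * χ)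
  rw [← integral_sub (hint φ) hφχ, ← Real.norm_eq_abs]
  calc ‖∫ ω, φ ((Z ω, M ω), V ω) - φ ((Z ω, M ω), V ω) * massCutoff E₁ E₂ k (Z ω, M ω) ∂P‖
      ≤ ∫ ω, ‖φ‖ * (1 - massCutoff E₁ E₂ k (Z ω, M ω)) ∂P := by
        refine norm_integral_le_of_norm_le (((integrable_const _).sub hχ).const_mul _)
          (ae_of_all _ fun ω => ?_)
        have h1 := massCutoff_le_one k (Z ω, M ω)
        rw [← mul_one_sub, norm_mul, Real.norm_of_nonneg (sub_nonneg.2 h1)]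
        exact mul_le_mul_of_nonneg_right (φ.norm_coe_le_norm _) (sub_nonneg.2 h1)
    _ = _ := by
        rw [integral_const_mul, integral_sub (integrable_const _) hχ]
        simp

lemma tendsto_integral_massCutoff (hmeas : AEStronglyMeasurable (fun ω => (Z ω, M ω)) P)
    (hpos : ∀ᵐ ω ∂P, 0 < (M ω : Measure E₂) univ) :
    Tendsto (fun k => ∫ ω, massCutoff E₁ E₂ k (Z ω, M ω) ∂P) atTop (𝓝 1) := by
  have h := tendsto_integral_of_dominated_convergence (f := fun _ => (1 : ℝ)) (fun _ => (1 : ℝ))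
    (fun k => (massCutoff E₁ E₂ k).continuous.comp_aestronglyMeasurable hmeas)
    (integrable_const _) (fun k => ae_of_all _ fun ω => ?_) ?_
  · rwa [integral_const, probReal_univ, one_smul] at h
  · rw [Real.norm_of_nonneg (massCutoff_nonneg k _)]
    exact massCutoff_le_one k _
  · filter_upwards [hpos] with ω hω
    exact tendsto_massCutoff (ne_zero_of_univ_pos hω)

end Sampling

/-- Lemma `absrandompts`: let `E₁, E₂` be Polish, `(Z⁽ⁿ⁾, M⁽ⁿ⁾)` random elements of
`E₁ × M_F(E₂)` with `M⁽ⁿ⁾(E₂) > 0` a.s., and `V⁽ⁿ⁾` conditionally i.i.d. samples from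
`M⁽ⁿ⁾/M⁽ⁿ⁾(E₂)` in the sense that the conditional expectation of `φ₂(V⁽ⁿ⁾)` given
`(Z⁽ⁿ⁾, M⁽ⁿ⁾)` is `∫ φ₂ dF_K(M⁽ⁿ⁾)`; similarly for the limit `(Z, M, V)`. If
`(Z⁽ⁿ⁾, M⁽ⁿ⁾) → (Z, M)` in distribution, then
`(Z⁽ⁿ⁾, M⁽ⁿ⁾, V⁽ⁿ⁾) → (Z, M, V)` in distribution. -/
theorem stmt18 {E₁ E₂ : Type*}
    [TopologicalSpace E₁] [PolishSpace E₁]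
    [TopologicalSpace E₂] [PolishSpace E₂] [MeasurableSpace E₂] [BorelSpace E₂]
    (K : ℕ)
    {Ω : Type*} [MeasurableSpace Ω]
    (Pn : ℕ → Measure Ω) (hPn : ∀ n, IsProbabilityMeasure (Pn n))
    (P : Measure Ω) [IsProbabilityMeasure P]
    (Zn : ℕ → Ω → E₁) (Mn : ℕ → Ω → FiniteMeasure E₂) (Vn : ℕ → Ω → Fin K → E₂)
    (Z : Ω → E₁) (M : Ω → FiniteMeasure E₂) (V : Ω → Fin K → E₂)
    (hmeasn : ∀ n, AEStronglyMeasurable (fun ω => (Zn n ω, Mn n ω, Vn n ω)) (Pn n))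
    (hmeas : AEStronglyMeasurable (fun ω => (Z ω, M ω, V ω)) P)
    (hposn : ∀ n, ∀ᵐ ω ∂(Pn n), 0 < (Mn n ω : Measure E₂) Set.univ)
    (hpos : ∀ᵐ ω ∂P, 0 < (M ω : Measure E₂) Set.univ)
    (hcondn : ∀ n, ∀ φ₂ : (Fin K → E₂) →ᵇ ℝ,
        (Pn n)[(fun ω => φ₂ (Vn n ω)) |
            MeasurableSpace.comap (fun ω => (Zn n ω, Mn n ω))
              (borel (E₁ × FiniteMeasure E₂))]
          =ᵐ[Pn n] fun ω => ∫ x, φ₂ x ∂(FKmeas K (Mn n ω : Measure E₂)))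
    (hcond : ∀ φ₂ : (Fin K → E₂) →ᵇ ℝ,
        P[(fun ω => φ₂ (V ω)) |
            MeasurableSpace.comap (fun ω => (Z ω, M ω))
              (borel (E₁ × FiniteMeasure E₂))]
          =ᵐ[P] fun ω => ∫ x, φ₂ x ∂(FKmeas K (M ω : Measure E₂)))
    (hweak : ∀ φ : (E₁ × FiniteMeasure E₂) →ᵇ ℝ,
        Tendsto (fun n => ∫ ω, φ (Zn n ω, Mn n ω) ∂(Pn n)) atTop
          (nhds (∫ ω, φ (Z ω, M ω) ∂P))) :
    ∀ φ : (E₁ × FiniteMeasure E₂ × (Fin K → E₂)) →ᵇ ℝ,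
      Tendsto (fun n => ∫ ω, φ (Zn n ω, Mn n ω, Vn n ω) ∂(Pn n)) atTop
        (nhds (∫ ω, φ (Z ω, M ω, V ω) ∂P)) := by
  intro φ
  have := hPn
  have : Nonempty E₂ := nonempty_of_ae_univ_pos hpos
  set φ' : (E₁ × FiniteMeasure E₂) × (Fin K → E₂) →ᵇ ℝ :=
    φ.compContinuous ⟨fun p => (p.1.1, p.1.2, p.2), by fun_prop⟩
  choose Ψ hΨ using fun k => exists_boundedContinuousFunction_damped K φ' (massCutoff E₁ E₂ k)
    fun _ hx => massCutoff_eq_zero k hx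
  have hdamp : ∀ (Q : Measure Ω) [IsProbabilityMeasure Q] (z : Ω → E₁) (m : Ω → FiniteMeasure E₂)
      (v : Ω → Fin K → E₂), AEStronglyMeasurable (fun ω => (z ω, m ω, v ω)) Q →
      (∀ᵐ ω ∂Q, 0 < (m ω : Measure E₂) univ) →
      (∀ φ₂ : (Fin K → E₂) →ᵇ ℝ,
        Q[(fun ω => φ₂ (v ω)) | MeasurableSpace.comap (fun ω => (z ω, m ω))
            (borel (E₁ × FiniteMeasure E₂))]
          =ᵐ[Q] fun ω => ∫ x, φ₂ x ∂(FKmeas K (m ω : Measure E₂))) →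
      ∀ k, |∫ ω, φ (z ω, m ω, v ω) ∂Q - ∫ ω, Ψ k (z ω, m ω) ∂Q|
        ≤ ‖φ'‖ * (1 - ∫ ω, massCutoff E₁ E₂ k (z ω, m ω) ∂Q) := by
    intro Q _ z m v hz hm hc k
    have h := integral_eq_integral_pi_normalize hz hm hc
      (φ' * (massCutoff E₁ E₂ k).compContinuous ⟨Prod.fst, continuous_fst⟩)
    simp_rw [hΨ]
    exact h ▸ abs_integral_sub_integral_massCutoff_le hz φ' k
  refine tendsto_of_forall_abs_sub_le (fun k => hweak (Ψ k))
    (fun k => ((hweak (massCutoff E₁ E₂ k)).const_sub 1).const_mul ‖φ'‖) ?_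
    (fun k n => hdamp (Pn n) _ _ _ (hmeasn n) (hposn n) (hcondn n) k)
    (hdamp P _ _ _ hmeas hpos hcond)
  have hZM : AEStronglyMeasurable (fun ω => (Z ω, M ω)) P :=
    Continuous.comp_aestronglyMeasurable
      (g := fun p : E₁ × FiniteMeasure E₂ × (Fin K → E₂) => (p.1, p.2.1)) (by fun_prop) hmeas
  simpa using ((tendsto_integral_massCutoff hZM hpos).const_sub 1).const_mul ‖φ'‖
end
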